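/- For every ν ∈ [-1/2, 1) and every real x > 0, the inequality 3·ln(1 + x/3) − ln(1 + (1+2ν)x/3) − 2·ln(1 + (1−ν)x/3) ≤ (ν²(5−2ν)/3) · (3·ln(1 + x/3) − ln(1 + x)) holds. -/

import Mathlib

/-- The derivative of the difference of the two sides is nonnegative. -/
theorem deriv_gap_nonneg {ν y : ℝ} (hν1 : -1/2 ≤ ν) (hν2 : ν < 1) (hy : 0 ≤ y) :
    0 ≤ (ν^2 * (5 - 2*ν) / 3) * (3 * ((1/3) / (1 + y/3)) - 1 / (1 + y))
      - (3 * ((1/3) / (1 + y/3)) - ((1+2*ν)/3) / (1 + (1+2*ν)*y/3)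
        - 2 * (((1-ν)/3) / (1 + (1-ν)*y/3))) := by
  have ha : 0 ≤ 1 + 2*ν := by linarith
  have hb : 0 ≤ 1 - ν := by linarith
  have hc : 0 ≤ 5 - 2*ν := by linarith
  have h1 : 0 < 3 + y := by linarith
  have h2 : 0 < 1 + y := by linarith
  have h3 : 0 < 3 + (1+2*ν)*y := by positivity
  have h4 : 0 < 3 + (1-ν)*y := by positivity
  have e1 : 1 + y/3 = (3 + y)/3 := by ring
  have e3 : 1 + (1+2*ν)*y/3 = (3 + (1+2*ν)*y)/3 := by ring
  have e4 : 1 + (1-ν)*y/3 = (3 + (1-ν)*y)/3 := by ring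
  have key : (ν^2 * (5 - 2*ν) / 3) * (3 * ((1/3) / (1 + y/3)) - 1 / (1 + y))
      - (3 * ((1/3) / (1 + y/3)) - ((1+2*ν)/3) / (1 + (1+2*ν)*y/3)
        - 2 * (((1-ν)/3) / (1 + (1-ν)*y/3)))
      = 2 * ν^2 * y * (18*(1-ν) + 3*((1+2*ν)*(1-ν))*y + (5-2*ν)*((1+2*ν)*(1-ν))*y^2)
        / (3 * (3+y) * (1+y) * (3 + (1+2*ν)*y) * (3 + (1-ν)*y)) := by
    rw [e1, e3, e4]
    generalize hp : 3 + (1+2*ν)*y = p at h3 ⊢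
    generalize hq : 3 + (1-ν)*y = q at h4 ⊢
    field_simp
    rw [← hp, ← hq]
    ring
  rw [key]
  positivity

theorem stmt_0 (ν x : ℝ) (hν1 : -1/2 ≤ ν) (hν2 : ν < 1) (hx : 0 < x) :
    3 * Real.log (1 + x/3) - Real.log (1 + (1+2*ν)*x/3) - 2 * Real.log (1 + (1-ν)*x/3)
      ≤ (ν^2 * (5 - 2*ν) / 3) * (3 * Real.log (1 + x/3) - Real.log (1 + x)) := by
  let gap : ℝ → ℝ := fun y =>
    (ν^2 * (5 - 2*ν) / 3) * (3 * Real.log (1 + y/3) - Real.log (1 + y))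
      - (3 * Real.log (1 + y/3) - Real.log (1 + (1+2*ν)*y/3) - 2 * Real.log (1 + (1-ν)*y/3))
  have ha : 0 ≤ 1 + 2*ν := by linarith
  have hb : 0 ≤ 1 - ν := by linarith
  have hderiv : ∀ y : ℝ, 0 ≤ y → HasDerivAt gap
      ((ν^2 * (5 - 2*ν) / 3) * (3 * ((1/3) / (1 + y/3)) - 1 / (1 + y))
      - (3 * ((1/3) / (1 + y/3)) - ((1+2*ν)/3) / (1 + (1+2*ν)*y/3)
        - 2 * (((1-ν)/3) / (1 + (1-ν)*y/3)))) y := by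
    intro y hy
    have d1 : HasDerivAt (fun y : ℝ => Real.log (1 + y/3)) ((1/3) / (1 + y/3)) y :=
      (((hasDerivAt_id y).div_const 3).const_add 1).log (by simp only [id]; positivity)
    have d2 : HasDerivAt (fun y : ℝ => Real.log (1 + y)) (1 / (1 + y)) y :=
      ((hasDerivAt_id y).const_add 1).log (by simp only [id]; positivity)
    have d (c : ℝ) (hc : 0 ≤ c) :
        HasDerivAt (fun y : ℝ => Real.log (1 + c*y/3)) ((c/3) / (1 + c*y/3)) y := by
      have h := ((((hasDerivAt_id y).const_mul c).div_const 3).const_add 1).log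
        (by simp only [id]; positivity)
      simpa using h
    exact (((d1.const_mul 3).sub d2).const_mul _).sub
      (((d1.const_mul 3).sub (d _ ha)).sub ((d _ hb).const_mul 2))
  have hmono : MonotoneOn gap (Set.Ici 0) := by
    refine monotoneOn_of_deriv_nonneg (convex_Ici 0)
      (fun y hy => (hderiv y hy).continuousAt.continuousWithinAt)
      (fun y hy => (hderiv y (interior_subset hy)).differentiableAt.differentiableWithinAt) ?_
    intro y hy
    have hy' : 0 ≤ y := interior_subset hy
    rw [(hderiv y hy').deriv]
    exact deriv_gap_nonneg hν1 hν2 hy'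
  have h := hmono (Set.mem_Ici.mpr le_rfl) (Set.mem_Ici.mpr hx.le) hx.le
  have h0 : gap 0 = 0 := by simp [gap]
  rw [h0] at h
  exact sub_nonneg.mp h
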